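/- arXiv:2301.13196 — 11 statements merged into one kernel-verified Lean document; each statement's English description precedes it below -/
import Mathlib

section
/- For every d ≥ 1 there exist matrices W₁ ∈ ℝ^{8d×2d}, W₂ ∈ ℝ^{d×8d} and vectors b₁ ∈ ℝ^{8d}, b₂ ∈ ℝ^{d} such that for all natural numbers a, b with a + b < 2^d, if x ∈ ℝ^{2d} is the concatenation of the d-bit {0,1}-binary representations of a and b (least significant bit first), then W₂ · relu(W₁ x + b₁) + b₂ equals the d-bit {0,1}-binary representation of a + b. In other words, a one-hidden-layer feedforward ReLU network with 8d hidden activations and d output neurons computes binary addition of two d-bit numbers. -/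
open Matrix

/-- ReLU applied to a real number. -/
noncomputable def relu (x : ℝ) : ℝ := max x 0

/-- The `d`-bit `{0,1}`-binary representation of `m` (least significant bit first),
as a real vector: coordinate `i` is the bit of weight `2^i`. -/
noncomputable def binVec (d m : ℕ) : Fin d → ℝ := fun i => if Nat.testBit m i then 1 else 0

/-- Concatenation of the `d`-bit binary representations of `a` and `b`. -/
noncomputable def concatVec (d a b : ℕ) : Fin (2 * d) → ℝ := fun i =>
  if h : (i : ℕ) < d then binVec d a ⟨i, h⟩
  else binVec d b ⟨(i : ℕ) - d, by have := i.isLt; omega⟩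

lemma concat_zero (d a b : ℕ) (m : Fin d) :
    concatVec d a b (finProdFinEquiv ((0 : Fin 2), m)) = binVec d a m := by
  simp [concatVec, finProdFinEquiv]

lemma concat_one (d a b : ℕ) (m : Fin d) :
    concatVec d a b (finProdFinEquiv ((1 : Fin 2), m)) = binVec d b m := by
  simp [concatVec, finProdFinEquiv]

lemma sum_bits (a n : ℕ) :
    ∑ m ∈ Finset.range n, (2 : ℝ) ^ m * (if Nat.testBit a m then 1 else 0)
      = ((a % 2 ^ n : ℕ) : ℝ) := by
  induction n with
  | zero => simp [Nat.mod_one]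
  | succ n ih =>
    rw [Finset.sum_range_succ, ih, Nat.mod_pow_succ, Nat.testBit_eq_decide_div_mod_eq]
    rcases Nat.mod_two_eq_zero_or_one (a / 2 ^ n) with h | h <;> simp [h]

lemma sum_low (d a : ℕ) (i : Fin d) :
    ∑ m : Fin d, (if m ≤ i then (2 : ℝ) ^ (m : ℕ) else 0) * binVec d a m
      = ((a % 2 ^ ((i : ℕ) + 1) : ℕ) : ℝ) := by
  rw [← sum_bits]
  have h := Fin.sum_univ_eq_sum_range (fun m : ℕ => (if m ≤ (i : ℕ) then (2 : ℝ) ^ m else 0) *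
    (if Nat.testBit a m then 1 else 0)) d
  simp only [Fin.le_def, binVec]
  rw [h]
  have hi := i.isLt
  rw [← Finset.sum_subset (s₁ := Finset.range ((i : ℕ) + 1))]
  · apply Finset.sum_congr rfl
    intro m hm
    rw [Finset.mem_range] at hm
    rw [if_pos (by omega : m ≤ (i : ℕ))]
  · intro m hm
    rw [Finset.mem_range] at *
    omega
  · intro m _ hm
    rw [Finset.mem_range] at hm
    rw [if_neg (by omega : ¬ m ≤ (i : ℕ)), zero_mul]

/-- A unit step on the integers as a difference of two relus. -/
lemma relu_step (s c : ℕ) :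
    relu ((s : ℝ) + (1 - c)) - relu ((s : ℝ) + (-c)) = if c ≤ s then 1 else 0 := by
  unfold relu
  split_ifs with h
  · have : (c : ℝ) ≤ s := by exact_mod_cast h
    rw [max_eq_left (by linarith), max_eq_left (by linarith)]
    ring
  · have : (s : ℝ) + 1 ≤ c := by exact_mod_cast (by omega : s + 1 ≤ c)
    rw [max_eq_right (by linarith), max_eq_right (by linarith)]
    ring

lemma bit_steps (a b i : ℕ) :
    ((if 2 ^ i ≤ a % 2 ^ (i + 1) + b % 2 ^ (i + 1) then 1 else 0 : ℝ)
      - (if 2 * 2 ^ i ≤ a % 2 ^ (i + 1) + b % 2 ^ (i + 1) then 1 else 0)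
      + (if 3 * 2 ^ i ≤ a % 2 ^ (i + 1) + b % 2 ^ (i + 1) then 1 else 0))
      = if Nat.testBit (a + b) i then 1 else 0 := by
  have hp : 0 < 2 ^ i := by positivity
  have ha : a % 2 ^ (i + 1) < 2 ^ (i + 1) := Nat.mod_lt _ (by positivity)
  have hb : b % 2 ^ (i + 1) < 2 ^ (i + 1) := Nat.mod_lt _ (by positivity)
  have hs : Nat.testBit (a + b) i
      = Nat.testBit (a % 2 ^ (i + 1) + b % 2 ^ (i + 1)) i := by
    have h1 := Nat.testBit_mod_two_pow (a + b) (i + 1) i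
    have h2 := Nat.testBit_mod_two_pow (a % 2 ^ (i + 1) + b % 2 ^ (i + 1)) (i + 1) i
    rw [← Nat.add_mod] at h2
    rw [h1] at h2
    simpa only [Nat.lt_succ_self, decide_true, Bool.true_and] using h2
  rw [hs, Nat.testBit_eq_decide_div_mod_eq]
  rw [pow_succ] at ha hb
  generalize hS : a % 2 ^ (i + 1) + b % 2 ^ (i + 1) = S
  have hlt : S < 4 * 2 ^ i := by rw [← hS, pow_succ]; omega
  clear hS hs ha hb
  generalize 2 ^ i = P at *
  have key : S / P = 0 ∧ S < P ∨ S / P = 1 ∧ P ≤ S ∧ S < 2 * P ∨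
      S / P = 2 ∧ 2 * P ≤ S ∧ S < 3 * P ∨ S / P = 3 ∧ 3 * P ≤ S := by
    have h1 := Nat.div_mul_le_self S P
    have h2 := Nat.lt_div_mul_add (a := S) hp
    have h3 : S / P < 4 := Nat.div_lt_of_lt_mul (by linarith)
    interval_cases S / P <;> omega
  rcases key with ⟨h, h1⟩ | ⟨h, h1, h2⟩ | ⟨h, h1, h2⟩ | ⟨h, h1⟩
  · rw [h, if_neg (by omega), if_neg (by omega), if_neg (by omega)]; norm_num
  · rw [h, if_pos (by omega), if_neg (by omega), if_neg (by omega)]; norm_num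
  · rw [h, if_pos (by omega), if_pos (by omega), if_neg (by omega)]; norm_num
  · rw [h, if_pos (by omega), if_pos (by omega), if_pos (by omega)]; norm_num

/-- Offsets of the eight hidden units of one output bit (two are unused). -/
noncomputable def offs (P : ℕ) : Fin 8 → ℝ :=
  ![1 - (P : ℕ), -(P : ℕ), 1 - (2 * P : ℕ), -(2 * P : ℕ), 1 - (3 * P : ℕ), -(3 * P : ℕ), 0, 0]

/-- Output weights of the eight hidden units of one output bit. -/
noncomputable def coefs : Fin 8 → ℝ := ![1, -1, -1, 1, 1, -1, 0, 0]

/-- A one-hidden-layer feedforward ReLU network with `8d` hidden activations and `d`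
output neurons can compute binary addition of two `d`-bit numbers, provided the sum
fits in `d` bits. -/
theorem binary_addition_relu_network (d : ℕ) (hd : 1 ≤ d) :
    ∃ (W₁ : Matrix (Fin (8 * d)) (Fin (2 * d)) ℝ) (W₂ : Matrix (Fin d) (Fin (8 * d)) ℝ)
      (b₁ : Fin (8 * d) → ℝ) (b₂ : Fin d → ℝ),
      ∀ a b : ℕ, a + b < 2 ^ d →
        (W₂.mulVec (fun k => relu (W₁.mulVec (concatVec d a b) k + b₁ k)) + b₂)
          = binVec d (a + b) := by
  refine ⟨fun k m => if (finProdFinEquiv.symm m : Fin 2 × Fin d).2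
      ≤ (finProdFinEquiv.symm k : Fin 8 × Fin d).2
      then (2 : ℝ) ^ ((finProdFinEquiv.symm m : Fin 2 × Fin d).2 : ℕ) else 0,
    fun i k => if (finProdFinEquiv.symm k : Fin 8 × Fin d).2 = i
      then coefs (finProdFinEquiv.symm k : Fin 8 × Fin d).1 else 0,
    fun k => offs (2 ^ ((finProdFinEquiv.symm k : Fin 8 × Fin d).2 : ℕ))
      (finProdFinEquiv.symm k : Fin 8 × Fin d).1, 0, ?_⟩
  intro a b _
  rw [add_zero]
  funext i
  simp only [Matrix.mulVec, dotProduct]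
  rw [← Equiv.sum_comp (finProdFinEquiv (m := 8) (n := d)), Fintype.sum_prod_type]
  have inner : ∀ i : Fin d, ∑ m : Fin (2 * d),
      (if (finProdFinEquiv.symm m : Fin 2 × Fin d).2 ≤ i
      then (2 : ℝ) ^ ((finProdFinEquiv.symm m : Fin 2 × Fin d).2 : ℕ) else 0)
        * concatVec d a b m
      = ((a % 2 ^ ((i : ℕ) + 1) + b % 2 ^ ((i : ℕ) + 1) : ℕ) : ℝ) := by
    intro i
    rw [← Equiv.sum_comp (finProdFinEquiv (m := 2) (n := d)), Fintype.sum_prod_type]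
    simp only [Fin.sum_univ_two, concat_zero, concat_one, Equiv.symm_apply_apply, sum_low]
    push_cast
    rfl
  simp only [Equiv.symm_apply_apply, inner]
  simp only [ite_mul, zero_mul, Finset.sum_ite_eq',
    Finset.mem_univ, if_true]
  rw [binVec, ← bit_steps, ← relu_step, ← relu_step, ← relu_step]
  simp only [Fin.sum_univ_eight, coefs, offs]
  simp
  ring
end

section
/- Let i ≥ 1 and let a, b be natural numbers, and set s = (a mod 2^i) + (b mod 2^i) (so s < 2^{i+1}). Then the binary digit of weight 2^{i−1} of a + b equals the binary digit of weight 2^{i−1} of s, which equals 1 if and only if s ∈ [2^{i−1}, 2^i − 1] ∪ [3·2^{i−1}, 2^{i+1} − 1]; moreover, viewing s as a real number, this digit equals (relu(s − 2^{i−1} + 1) − relu(s − 2^{i−1})) + (relu(2^i − s) − relu(2^i − s − 1)) − 1 + (relu(s − 3·2^{i−1} + 1) − relu(s − 3·2^{i−1})). -/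
/-- The carry-aware formula for a single bit of a binary sum: the bit of weight
`2^(i-1)` of `a + b` equals the corresponding bit of `s = (a % 2^i) + (b % 2^i)`;
this bit is `1` iff `s ∈ [2^(i-1), 2^i - 1] ∪ [3·2^(i-1), 2^(i+1) - 1]`; and, as a
real number, it is computed exactly by the given one-hidden-layer ReLU expression. -/
theorem bit_of_sum_via_relu (i a b : ℕ) (hi : 1 ≤ i) (s : ℕ)
    (hs : s = a % 2 ^ i + b % 2 ^ i) :
    s < 2 ^ (i + 1) ∧
    (a + b).testBit (i - 1) = s.testBit (i - 1) ∧
    (s.testBit (i - 1) = true ↔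
      (2 ^ (i - 1) ≤ s ∧ s ≤ 2 ^ i - 1) ∨ (3 * 2 ^ (i - 1) ≤ s ∧ s ≤ 2 ^ (i + 1) - 1)) ∧
    ((if s.testBit (i - 1) then (1 : ℝ) else 0) =
      (relu ((s : ℝ) - 2 ^ (i - 1) + 1) - relu ((s : ℝ) - 2 ^ (i - 1)))
        + (relu ((2 : ℝ) ^ i - s) - relu ((2 : ℝ) ^ i - s - 1)) - 1
        + (relu ((s : ℝ) - 3 * 2 ^ (i - 1) + 1) - relu ((s : ℝ) - 3 * 2 ^ (i - 1)))) := by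
  obtain ⟨k, rfl⟩ : ∃ k, i = k + 1 := ⟨i - 1, by omega⟩
  have hp : 0 < 2 ^ k := by positivity
  have ha : a % 2 ^ (k + 1) < 2 ^ (k + 1) := Nat.mod_lt _ (by positivity)
  have hb : b % 2 ^ (k + 1) < 2 ^ (k + 1) := Nat.mod_lt _ (by positivity)
  have e1 : 2 ^ (k + 1) = 2 * 2 ^ k := by ring
  have e2 : 2 ^ (k + 1 + 1) = 4 * 2 ^ k := by ring
  have e3 : (2 : ℝ) ^ (k + 1) = 2 * 2 ^ k := by ring
  have hmod : (a + b) % 2 ^ (k + 1) = s % 2 ^ (k + 1) := by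
    rw [hs, Nat.add_mod]
  have hlt : s < 4 * 2 ^ k := by omega
  have hbit : (a + b).testBit k = s.testBit k := by
    have h1 := Nat.testBit_mod_two_pow (a + b) (k + 1) k
    have h2 := Nat.testBit_mod_two_pow s (k + 1) k
    rw [hmod, h2] at h1
    simpa using h1.symm
  have hchar : s.testBit k = true ↔
      (2 ^ k ≤ s ∧ s < 2 * 2 ^ k) ∨ (3 * 2 ^ k ≤ s ∧ s < 4 * 2 ^ k) := by
    rw [Nat.testBit_eq_decide_div_mod_eq, decide_eq_true_iff]
    have hq : s / 2 ^ k < 4 := (Nat.div_lt_iff_lt_mul hp).2 hlt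
    have hd := Nat.div_add_mod s (2 ^ k)
    have hm := Nat.mod_lt s hp
    generalize s / 2 ^ k = q at *
    interval_cases q <;> omega
  have step : ∀ x : ℝ, 0 ≤ x → relu (x + 1) - relu x = 1 := by
    intro x hx
    unfold relu
    rw [max_eq_left hx, max_eq_left (by linarith)]
    ring
  have step0 : ∀ x : ℝ, x + 1 ≤ 0 → relu (x + 1) - relu x = 0 := by
    intro x hx
    unfold relu
    rw [max_eq_right hx, max_eq_right (by linarith)]
    ring
  have up : ∀ c : ℕ, relu ((s : ℝ) - c + 1) - relu ((s : ℝ) - c) = if c ≤ s then 1 else 0 := by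
    intro c
    split_ifs with h
    · apply step
      have : (c : ℝ) ≤ s := by exact_mod_cast h
      linarith
    · apply step0
      have : (s : ℝ) + 1 ≤ c := by exact_mod_cast (not_le.1 h)
      linarith
  have down : ∀ c : ℕ, relu ((c : ℝ) - s) - relu ((c : ℝ) - s - 1) = if s < c then 1 else 0 := by
    intro c
    have e : (c : ℝ) - s = ((c : ℝ) - s - 1) + 1 := by ring
    nth_rewrite 1 [e]
    split_ifs with h
    · apply step
      have : (s : ℝ) + 1 ≤ c := by exact_mod_cast h
      linarith
    · apply step0
      have : (c : ℝ) ≤ s := by exact_mod_cast (not_lt.1 h)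
      linarith
  have u1 := up (2 ^ k)
  have u3 := up (3 * 2 ^ k)
  have d2 := down (2 * 2 ^ k)
  push_cast at u1 u3 d2
  simp only [Nat.add_sub_cancel]
  refine ⟨by omega, hbit, ?_, ?_⟩
  · rw [hchar]
    omega
  · rw [e3, u1, u3, d2]
    simp only [hchar]
    split_ifs <;> first | omega | norm_num
end

section
/- Let λ ≥ 0, n ≥ 1, z ∈ ℝ^n, and let a be an index such that z_j ≤ z_a − 1 for all j ≠ a. Then the softmax with temperature λ satisfies σ_S(z, λ)_a ≥ 1 − n·exp(−λ) and σ_S(z, λ)_j ≤ n·exp(−λ) for every j ≠ a. -/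
/-- Softmax with temperature `lam` of a vector `z ∈ ℝⁿ`. -/
noncomputable def softmax {n : ℕ} (lam : ℝ) (z : Fin n → ℝ) : Fin n → ℝ := fun i =>
  Real.exp (lam * z i) / ∑ k, Real.exp (lam * z k)

/-- If one coordinate dominates all others by at least `1`, the softmax with
temperature `lam` puts mass at least `1 - n·e^{-lam}` on it, and at most `n·e^{-lam}`
on every other coordinate. -/
theorem softmax_concentrates (lam : ℝ) (hlam : 0 ≤ lam) (n : ℕ) (hn : 1 ≤ n)
    (z : Fin n → ℝ) (a : Fin n) (hz : ∀ j, j ≠ a → z j ≤ z a - 1) :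
    1 - n * Real.exp (-lam) ≤ softmax lam z a ∧
    ∀ j, j ≠ a → softmax lam z j ≤ n * Real.exp (-lam) := by
  have hS : 0 < ∑ k, Real.exp (lam * z k) :=
    Finset.sum_pos (fun _ _ => Real.exp_pos _) ⟨a, Finset.mem_univ a⟩
  have hE := Real.exp_pos (-lam)
  have hn' : (1 : ℝ) ≤ n := by exact_mod_cast hn
  have key : ∀ j, j ≠ a → softmax lam z j ≤ Real.exp (-lam) := by
    intro j hj
    unfold softmax
    rw [div_le_iff₀ hS]
    have h1 : Real.exp (lam * z a) ≤ ∑ k, Real.exp (lam * z k) :=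
      Finset.single_le_sum (f := fun k => Real.exp (lam * z k))
        (fun _ _ => (Real.exp_pos _).le) (Finset.mem_univ a)
    calc Real.exp (lam * z j) ≤ Real.exp (-lam + lam * z a) := by
          apply Real.exp_le_exp.mpr
          nlinarith [mul_le_mul_of_nonneg_left (hz j hj) hlam]
      _ = Real.exp (-lam) * Real.exp (lam * z a) := Real.exp_add _ _
      _ ≤ _ := mul_le_mul_of_nonneg_left h1 hE.le
  have hsum : ∑ k, softmax lam z k = 1 := by
    unfold softmax
    rw [← Finset.sum_div, div_self hS.ne']
  refine ⟨?_, fun j hj => (key j hj).trans (by nlinarith)⟩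
  rw [← Finset.add_sum_erase _ _ (Finset.mem_univ a)] at hsum
  have h2 : ∑ k ∈ Finset.univ.erase a, softmax lam z k
      ≤ ∑ k ∈ Finset.univ.erase a, Real.exp (-lam) :=
    Finset.sum_le_sum fun k hk => key k (Finset.ne_of_mem_erase hk)
  have h3 : ∑ k ∈ Finset.univ.erase a, Real.exp (-lam) ≤ ∑ k : Fin n, Real.exp (-lam) :=
    Finset.sum_le_sum_of_subset_of_nonneg (Finset.erase_subset _ _) fun _ _ _ => hE.le
  have h4 : ∑ k : Fin n, Real.exp (-lam) = n * Real.exp (-lam) := by simp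
  linarith
end

section
/- Let λ ≥ 0, n ≥ 2, and z ∈ ℝ^n, and suppose there are two distinct indices a, b with z_a = z_b and z_j ≤ z_a − 1 for all j ∉ {a, b}. Then |σ_S(z, λ)_a − 1/2| ≤ n·exp(−λ), |σ_S(z, λ)_b − 1/2| ≤ n·exp(−λ), and σ_S(z, λ)_j ≤ n·exp(−λ) for every j ∉ {a, b}. -/
/-- If two coordinates are equal and dominate all others by at least `1`, the softmax
with temperature `lam` puts mass `1/2 ± n·e^{-lam}` on each of them, and at most
`n·e^{-lam}` on every other coordinate. -/
theorem softmax_two_maxima (lam : ℝ) (hlam : 0 ≤ lam) (n : ℕ) (hn : 2 ≤ n)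
    (z : Fin n → ℝ) (a b : Fin n) (hab : a ≠ b) (hzab : z a = z b)
    (hz : ∀ j, j ≠ a → j ≠ b → z j ≤ z a - 1) :
    |softmax lam z a - 1 / 2| ≤ n * Real.exp (-lam) ∧
    |softmax lam z b - 1 / 2| ≤ n * Real.exp (-lam) ∧
    ∀ j, j ≠ a → j ≠ b → softmax lam z j ≤ n * Real.exp (-lam) := by
  have hM : 0 < Real.exp (lam * z a) := Real.exp_pos _
  have hE : 0 < Real.exp (-lam) := Real.exp_pos _
  have hj : ∀ j, j ≠ a → j ≠ b →
      Real.exp (lam * z j) ≤ Real.exp (-lam) * Real.exp (lam * z a) := by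
    intro j h1 h2
    rw [← Real.exp_add]
    apply Real.exp_le_exp.mpr
    nlinarith [mul_le_mul_of_nonneg_left (hz j h1 h2) hlam]
  have hb : Real.exp (lam * z b) = Real.exp (lam * z a) := by rw [hzab]
  obtain ⟨R, hR0, hR1, hS⟩ : ∃ R : ℝ, 0 ≤ R ∧
      R ≤ n * (Real.exp (-lam) * Real.exp (lam * z a)) ∧
      ∑ k, Real.exp (lam * z k) = 2 * Real.exp (lam * z a) + R := by
    refine ⟨∑ k ∈ (Finset.univ.erase a).erase b, Real.exp (lam * z k),
      Finset.sum_nonneg fun _ _ => (Real.exp_pos _).le, ?_, ?_⟩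
    · refine (Finset.sum_le_card_nsmul _ _
        (Real.exp (-lam) * Real.exp (lam * z a)) ?_).trans ?_
      · intro j h
        simp only [Finset.mem_erase, Finset.mem_univ, and_true] at h
        exact hj j h.2 h.1
      · rw [nsmul_eq_mul]
        apply mul_le_mul_of_nonneg_right _ (by positivity)
        have := Finset.card_le_univ ((Finset.univ.erase a).erase b)
        rw [Fintype.card_fin] at this
        exact_mod_cast this
    · rw [← Finset.add_sum_erase Finset.univ _ (Finset.mem_univ a),
        ← Finset.add_sum_erase (Finset.univ.erase a) _
          (Finset.mem_erase.mpr ⟨hab.symm, Finset.mem_univ b⟩), hb]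
      ring
  have hn' : (2 : ℝ) ≤ n := by exact_mod_cast hn
  have hnE : 0 ≤ n * Real.exp (-lam) := by positivity
  have key : |Real.exp (lam * z a) / (2 * Real.exp (lam * z a) + R) - 1 / 2|
      ≤ n * Real.exp (-lam) := by
    have hS0 : 0 < 2 * Real.exp (lam * z a) + R := by linarith
    have e : Real.exp (lam * z a) / (2 * Real.exp (lam * z a) + R) - 1 / 2
        = -(R / (2 * (2 * Real.exp (lam * z a) + R))) := by
      field_simp
      ring
    rw [e, abs_neg, abs_of_nonneg (by positivity), div_le_iff₀ (by positivity)]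
    nlinarith [mul_nonneg hnE hM.le, mul_nonneg hnE hR0]
  refine ⟨?_, ?_, ?_⟩
  · simpa only [softmax, hS] using key
  · simpa only [softmax, hS, hb] using key
  · intro j h1 h2
    simp only [softmax, hS]
    rw [div_le_iff₀ (by positivity)]
    have := hj j h1 h2
    nlinarith [mul_nonneg hnE hM.le, mul_nonneg hnE hR0, mul_pos hE hM]
end

section
/- Let G ≥ 1, d ≥ 1, n ≥ 1, ε > 0, and λ ≥ log(G·d·n³/ε). Let X ∈ ℝ^{d×n} satisfy |X_{kj}| ≤ G for all entries, and let Z ∈ ℝ^{n×n} be such that for every column j there is an index a(j) with Z_{ij} ≤ Z_{a(j) j} − 1 for all i ≠ a(j). Define P ∈ ℝ^{n×n} by P_{ij} = exp(λ Z_{ij}) / Σ_{k=1}^n exp(λ Z_{kj}) (columnwise softmax with temperature λ), and let P* ∈ ℝ^{n×n} be the 0/1 matrix with P*_{ij} = 1 if i = a(j) and 0 otherwise. Then max_{1 ≤ j ≤ n} Σ_{k=1}^d |(X P)_{kj} − (X P*)_{kj}| ≤ ε. -/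
open Matrix

/-- If the temperature of the columnwise softmax is at least `log(G d n³ / ε)` and, in
every column of `Z`, one entry dominates all others by at least `1`, then the product
`X P` of a `G`-bounded matrix `X` with the softmax matrix `P` differs from `X P*`
(where `P*` is the corresponding hard 0/1 selection matrix) by at most `ε` in maximum
column-wise `ℓ₁` norm. -/
theorem softmax_read_write_error (G : ℝ) (hG : 1 ≤ G) (d n : ℕ) (hd : 1 ≤ d)
    (hn : 1 ≤ n) (ε lam : ℝ) (hε : 0 < ε)
    (hlam : Real.log (G * d * n ^ 3 / ε) ≤ lam)
    (X : Matrix (Fin d) (Fin n) ℝ) (hX : ∀ k j, |X k j| ≤ G)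
    (Z : Matrix (Fin n) (Fin n) ℝ) (a : Fin n → Fin n)
    (hZ : ∀ j i, i ≠ a j → Z i j ≤ Z (a j) j - 1)
    (P Pstar : Matrix (Fin n) (Fin n) ℝ)
    (hP : ∀ i j, P i j = Real.exp (lam * Z i j) / ∑ k, Real.exp (lam * Z k j))
    (hPstar : ∀ i j, Pstar i j = if i = a j then 1 else 0) :
    ∀ j, ∑ k, |(X * P) k j - (X * Pstar) k j| ≤ ε := by
  intro j
  have hn' : (1 : ℝ) ≤ n := by exact_mod_cast hn
  have hd' : (1 : ℝ) ≤ d := by exact_mod_cast hd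
  have hS : 0 < ∑ k, Real.exp (lam * Z k j) :=
    Finset.sum_pos (fun _ _ => Real.exp_pos _) ⟨a j, Finset.mem_univ _⟩
  have hle : ∀ i, Real.exp (lam * Z i j) ≤ ∑ k, Real.exp (lam * Z k j) := fun i =>
    Finset.single_le_sum (f := fun k => Real.exp (lam * Z k j))
      (fun _ _ => (Real.exp_pos _).le) (Finset.mem_univ i)
  have hP0 : ∀ i, 0 ≤ P i j := fun i => by
    rw [hP]; exact div_nonneg (Real.exp_pos _).le hS.le
  have hP1 : ∑ i, P i j = 1 := by
    simp only [hP]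
    rw [← Finset.sum_div, div_self hS.ne']
  have hE : Real.exp (-lam) * (G * d * n ^ 3) ≤ ε := by
    have h0 : 0 < G * d * n ^ 3 / ε := by positivity
    have h1 := (Real.log_le_iff_le_exp h0).1 hlam
    rw [div_le_iff₀ hε] at h1
    calc Real.exp (-lam) * (G * d * n ^ 3) ≤ Real.exp (-lam) * (Real.exp lam * ε) := by gcongr
      _ = ε := by rw [← mul_assoc, ← Real.exp_add]; simp
  have hPi : ∀ i, i ≠ a j → P i j ≤ Real.exp (-lam) := by
    intro i hi
    rw [hP, div_le_iff₀ hS]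
    rcases le_total 0 lam with h | h
    · calc Real.exp (lam * Z i j) ≤ Real.exp (-lam + lam * Z (a j) j) := by
            apply Real.exp_le_exp.2
            nlinarith [mul_le_mul_of_nonneg_left (hZ j i hi) h]
        _ = Real.exp (-lam) * Real.exp (lam * Z (a j) j) := Real.exp_add _ _
        _ ≤ _ := by gcongr; exact hle _
    · have : 1 ≤ Real.exp (-lam) := Real.one_le_exp (by linarith)
      nlinarith [hle i]
  have hrest : ∑ i ∈ Finset.univ.erase (a j), P i j ≤ (n - 1) * Real.exp (-lam) := by
    have h := Finset.sum_le_card_nsmul (Finset.univ.erase (a j)) (fun i => P i j)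
      (Real.exp (-lam)) (fun i hi => hPi i (Finset.ne_of_mem_erase hi))
    rw [Finset.card_erase_of_mem (Finset.mem_univ _), Finset.card_univ, Fintype.card_fin,
      nsmul_eq_mul, Nat.cast_sub hn, Nat.cast_one] at h
    exact h
  have hsplit : P (a j) j + ∑ i ∈ Finset.univ.erase (a j), P i j = 1 := by
    rw [Finset.add_sum_erase _ (fun i => P i j) (Finset.mem_univ _), hP1]
  have hrest0 : 0 ≤ ∑ i ∈ Finset.univ.erase (a j), P i j :=
    Finset.sum_nonneg (fun i _ => hP0 i)
  have hdiff : ∑ i, |P i j - Pstar i j| ≤ 2 * ((n - 1) * Real.exp (-lam)) := by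
    rw [← Finset.add_sum_erase _ _ (Finset.mem_univ (a j))]
    have h1 : |P (a j) j - Pstar (a j) j| = ∑ i ∈ Finset.univ.erase (a j), P i j := by
      rw [hPstar, if_pos rfl, abs_of_nonpos (by linarith)]; linarith
    have h2 : ∑ i ∈ Finset.univ.erase (a j), |P i j - Pstar i j|
        = ∑ i ∈ Finset.univ.erase (a j), P i j := by
      refine Finset.sum_congr rfl fun i hi => ?_
      rw [hPstar, if_neg (Finset.ne_of_mem_erase hi), sub_zero, abs_of_nonneg (hP0 i)]
    rw [h1, h2]; linarith
  have hrow : ∀ k, |(X * P) k j - (X * Pstar) k j| ≤ G * (2 * ((n - 1) * Real.exp (-lam))) := by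
    intro k
    rw [Matrix.mul_apply, Matrix.mul_apply, ← Finset.sum_sub_distrib]
    calc |∑ i, (X k i * P i j - X k i * Pstar i j)|
        ≤ ∑ i, |X k i * P i j - X k i * Pstar i j| := Finset.abs_sum_le_sum_abs _ _
      _ ≤ ∑ i, G * |P i j - Pstar i j| := by
          refine Finset.sum_le_sum fun i _ => ?_
          rw [← mul_sub, abs_mul]
          exact mul_le_mul_of_nonneg_right (hX k i) (abs_nonneg _)
      _ = G * ∑ i, |P i j - Pstar i j| := by rw [Finset.mul_sum]
      _ ≤ _ := by gcongr
  have hsum := Finset.sum_le_card_nsmul Finset.univ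
    (fun k => |(X * P) k j - (X * Pstar) k j|) _ (fun k _ => hrow k)
  rw [Finset.card_univ, Fintype.card_fin, nsmul_eq_mul] at hsum
  have hcube : 2 * ((n : ℝ) - 1) ≤ n ^ 3 := by
    have h1 : 2 * ((n : ℝ) - 1) ≤ n ^ 2 := by nlinarith [sq_nonneg ((n : ℝ) - 1)]
    have h2 : (n : ℝ) ^ 2 ≤ n ^ 3 := pow_le_pow_right₀ hn' (by norm_num)
    linarith
  calc _ ≤ _ := hsum
    _ = Real.exp (-lam) * (G * d * (2 * ((n : ℝ) - 1))) := by ring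
    _ ≤ Real.exp (-lam) * (G * d * n ^ 3) := by gcongr
    _ ≤ ε := hE
end

section
/- Let 0 ≤ ε < 1/2, let b₀ ∈ {−1, 0, 1}, and let b ∈ ℝ satisfy |b − b₀| ≤ ε. Then (1/(1 − 2ε)) · (relu(b + 1 − ε) − relu(b + ε) + relu(b − ε) − relu(b − 1 + ε)) − 1 = b₀. That is, a noisy copy of a value in {−1, 0, 1} corrupted by additive error at most ε < 1/2 can be exactly corrected by a one-hidden-layer ReLU expression. -/
/-- Error correction: a noisy copy `b` of a value `b₀ ∈ {-1, 0, 1}`, corrupted by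
additive error at most `ε < 1/2`, is exactly recovered by a one-hidden-layer ReLU
expression. -/
theorem error_correction_relu (ε : ℝ) (hε0 : 0 ≤ ε) (hε : ε < 1 / 2)
    (b₀ : ℝ) (hb₀ : b₀ = -1 ∨ b₀ = 0 ∨ b₀ = 1) (b : ℝ) (hb : |b - b₀| ≤ ε) :
    (1 / (1 - 2 * ε)) *
        (relu (b + 1 - ε) - relu (b + ε) + relu (b - ε) - relu (b - 1 + ε)) - 1 = b₀ := by
  obtain ⟨h1, h2⟩ := abs_le.mp hb
  have hne : 1 - 2 * ε ≠ 0 := by linarith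
  unfold relu
  rcases hb₀ with rfl | rfl | rfl
  · rw [max_eq_right (by linarith : b + 1 - ε ≤ 0), max_eq_right (by linarith : b + ε ≤ 0),
      max_eq_right (by linarith : b - ε ≤ 0), max_eq_right (by linarith : b - 1 + ε ≤ 0)]
    ring
  · rw [max_eq_left (by linarith : 0 ≤ b + 1 - ε), max_eq_left (by linarith : 0 ≤ b + ε),
      max_eq_right (by linarith : b - ε ≤ 0), max_eq_right (by linarith : b - 1 + ε ≤ 0)]
    have e : b + 1 - ε - (b + ε) + 0 - 0 = 1 - 2 * ε := by ring
    rw [e, one_div_mul_cancel hne]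
    ring
  · rw [max_eq_left (by linarith : 0 ≤ b + 1 - ε), max_eq_left (by linarith : 0 ≤ b + ε),
      max_eq_left (by linarith : 0 ≤ b - ε), max_eq_left (by linarith : 0 ≤ b - 1 + ε)]
    have e : b + 1 - ε - (b + ε) + (b - ε) - (b - 1 + ε) = (1 - 2 * ε) * 2 := by ring
    rw [e, ← mul_assoc, one_div_mul_cancel hne]
    ring
end

section
/- Let m ≥ 2, z ∈ ℝ^m, C ∈ ℝ, and let i be an index in {1, …, m}. Then |exp(z_i) / (exp(z_i) + Σ_{j ≠ i} exp(z_j − C) + 1) − σ(z_i)| ≤ (m − 1) · exp((max_{1 ≤ j ≤ m} z_j) − C). In particular, as C → ∞ the softmax-type quantity on the left converges to the sigmoid σ(z_i). -/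
/-- The sigmoid function `σ(t) = 1/(1 + e^{-t})`. -/
noncomputable def sigmoid (t : ℝ) : ℝ := 1 / (1 + Real.exp (-t))

/-- Suppressing all off-diagonal softmax contributions by a large constant `C` makes a
softmax-type quantity converge to the sigmoid of the selected coordinate, with error at
most `(m - 1)·e^{max_j z_j - C}`. -/
theorem softmax_approx_sigmoid (m : ℕ) (hm : 2 ≤ m) (z : Fin m → ℝ) (C : ℝ)
    (i : Fin m) :
    |Real.exp (z i) /
        (Real.exp (z i) + (∑ j ∈ Finset.univ.erase i, Real.exp (z j - C)) + 1)
      - sigmoid (z i)|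
      ≤ ((m : ℝ) - 1) *
          Real.exp (Finset.univ.sup' ⟨i, Finset.mem_univ i⟩ z - C) := by
  have hS0 : 0 ≤ ∑ j ∈ Finset.univ.erase i, Real.exp (z j - C) :=
    Finset.sum_nonneg fun j _ => (Real.exp_pos _).le
  have hS : ∑ j ∈ Finset.univ.erase i, Real.exp (z j - C) ≤ ((m : ℝ) - 1) *
      Real.exp (Finset.univ.sup' ⟨i, Finset.mem_univ i⟩ z - C) := by
    have h := Finset.sum_le_card_nsmul (Finset.univ.erase i)
      (fun j => Real.exp (z j - C))
      (Real.exp (Finset.univ.sup' ⟨i, Finset.mem_univ i⟩ z - C))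
      (fun j _ => Real.exp_le_exp.mpr
        (sub_le_sub_right (Finset.le_sup' z (Finset.mem_univ j)) C))
    rw [Finset.card_erase_of_mem (Finset.mem_univ i), Finset.card_univ, Fintype.card_fin,
      nsmul_eq_mul, Nat.cast_sub (by omega), Nat.cast_one] at h
    exact h
  refine le_trans ?_ hS
  generalize ∑ j ∈ Finset.univ.erase i, Real.exp (z j - C) = S at hS0
  have he := Real.exp_pos (z i)
  have hsig : sigmoid (z i) = Real.exp (z i) / (Real.exp (z i) + 1) := by
    unfold sigmoid
    rw [Real.exp_neg]
    field_simp
  rw [hsig]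
  generalize Real.exp (z i) = e at he
  have h1 : 0 < e + S + 1 := by linarith
  have h2 : 0 < e + 1 := by linarith
  have key : e / (e + S + 1) - e / (e + 1) = -(e * S / ((e + S + 1) * (e + 1))) := by
    field_simp
    ring
  rw [key, abs_neg, abs_of_nonneg (by positivity), div_le_iff₀ (by positivity)]
  have h3 : e ≤ (e + S + 1) * (e + 1) := by nlinarith [mul_nonneg he.le hS0]
  nlinarith [mul_le_mul_of_nonneg_left h3 hS0]
end

section
/- Let n ≥ 1, G ≥ 0, c ≥ 0, C ∈ ℝ, and let x_1, …, x_n ∈ ℝ satisfy |x_k| ≤ G for all k. Then for every index j, |n·exp(C)·exp(c x_j) / (Σ_{k=1}^n exp(c x_k) + n(exp(C) + 1)) − (1 + c x_j)| ≤ exp(cG)(exp(cG) + 1)·exp(−C) + (cG)²·exp(cG). That is, a softmax column rescaled by n·exp(C) linearizes to 1 + c x_j, with error controlled by taking C large and c small. -/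
/-- Linearization of the softmax: a softmax column rescaled by `n·e^C` approximates the
affine function `1 + c·x_j`, with error controlled by taking `C` large and `c` small. -/
theorem softmax_linearization (n : ℕ) (hn : 1 ≤ n) (G c C : ℝ) (hG : 0 ≤ G)
    (hc : 0 ≤ c) (x : Fin n → ℝ) (hx : ∀ k, |x k| ≤ G) (j : Fin n) :
    |(n : ℝ) * Real.exp C * Real.exp (c * x j) /
        ((∑ k, Real.exp (c * x k)) + n * (Real.exp C + 1))
      - (1 + c * x j)|
      ≤ Real.exp (c * G) * (Real.exp (c * G) + 1) * Real.exp (-C)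
        + (c * G) ^ 2 * Real.exp (c * G) := by
  have hn' : (0 : ℝ) < n := by exact_mod_cast hn
  have hb : ∀ k, |c * x k| ≤ c * G := fun k => by
    rw [abs_mul, abs_of_nonneg hc]
    exact mul_le_mul_of_nonneg_left (hx k) hc
  have hle : ∀ k, Real.exp (c * x k) ≤ Real.exp (c * G) := fun k =>
    Real.exp_le_exp.2 ((le_abs_self _).trans (hb k))
  have hS0 : 0 ≤ ∑ k, Real.exp (c * x k) :=
    Finset.sum_nonneg fun k _ => (Real.exp_pos _).le
  have hS : ∑ k, Real.exp (c * x k) ≤ n * Real.exp (c * G) := by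
    have h := Finset.sum_le_sum (s := Finset.univ) fun k _ => hle k
    simpa using h
  have hA1 : 1 ≤ Real.exp (c * G) := Real.one_le_exp (mul_nonneg hc hG)
  have hE := Real.exp_pos C
  have haA := hle j
  have ha := Real.exp_pos (c * x j)
  have hbj := hb j
  rw [Real.exp_neg]
  generalize hSd : ∑ k, Real.exp (c * x k) = S at *
  generalize c * G = g at *
  generalize c * x j = t at *
  have hquad0 := Real.add_one_le_exp t
  have hquad : Real.exp t - 1 - t ≤ g ^ 2 * Real.exp g := by
    have h1 : Real.exp t * (1 - t) ≤ 1 := by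
      have h2 := mul_le_mul_of_nonneg_left (Real.add_one_le_exp (-t)) ha.le
      rw [← Real.exp_add] at h2
      simp only [add_neg_cancel, Real.exp_zero] at h2
      linarith
    have h3 : t ^ 2 ≤ g ^ 2 := sq_le_sq' (by linarith [neg_abs_le t]) (by linarith [le_abs_self t])
    have h4 : Real.exp t - 1 - t ≤ t ^ 2 * Real.exp g := by
      rcases le_total 0 t with ht | ht
      · have h5 : t * (Real.exp t - 1) ≤ t * (t * Real.exp t) :=
          mul_le_mul_of_nonneg_left (by linarith) ht
        have h6 := mul_le_mul_of_nonneg_left haA (sq_nonneg t)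
        nlinarith
      · have h5 := mul_le_mul_of_nonpos_left hquad0 ht
        have h6 := mul_le_mul_of_nonneg_left hA1 (sq_nonneg t)
        nlinarith
    exact h4.trans (mul_le_mul_of_nonneg_right h3 (Real.exp_pos g).le)
  generalize Real.exp t = a at *
  generalize Real.exp g = A at *
  generalize Real.exp C = E at *
  have hnE : 0 < n * E := mul_pos hn' hE
  have hD : 0 < S + n * (E + 1) := by nlinarith
  have heq : n * E * a / (S + n * (E + 1)) = a - a * (S + n) / (S + n * (E + 1)) := by
    field_simp
    ring
  have h0 : 0 ≤ a * (S + n) / (S + n * (E + 1)) := by positivity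
  have h1 : a * (S + n) / (S + n * (E + 1)) ≤ A * (A + 1) * E⁻¹ := by
    have h2 : A * (A + 1) * E⁻¹ = A * (n * A + n) / (n * E) := by
      field_simp
    rw [h2]
    have hA0 : 0 ≤ A := by linarith
    apply div_le_div₀ (by positivity) _ hnE (by nlinarith)
    exact mul_le_mul haA (by linarith) (by positivity) hA0
  have h7 : 0 ≤ g ^ 2 * A := mul_nonneg (sq_nonneg g) (by linarith)
  rw [heq, abs_le]
  constructor <;> linarith
end

section
/- There exists a constant K > 0 such that for all ε, δ ∈ (0, 1] and all C ≥ 1, there exist a natural number m with m ≤ K·(log(1/(εδ))/(εδ) + log C + 1), coefficients c_1, …, c_m ∈ ℝ and thresholds t_1, …, t_m ∈ ℝ such that for every x ∈ [−C, −δ] ∪ [δ, C], |Σ_{i=1}^m c_i · 1_{x ≥ t_i} − 1/x| ≤ ε. -/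
lemma count_le (N : ℕ) (y : ℝ) (hy : 0 ≤ y) (hN : y ≤ N) :
    |(∑ k : Fin N, if ((k : ℕ) : ℝ) + 1 ≤ y then (1 : ℝ) else 0) - y| ≤ 1 := by
  have h : (∑ k : Fin N, if ((k : ℕ) : ℝ) + 1 ≤ y then (1 : ℝ) else 0) = (⌊y⌋₊ : ℝ) := by
    rw [Fin.sum_univ_eq_sum_range (fun k => if (k : ℝ) + 1 ≤ y then (1 : ℝ) else 0) N,
      Finset.sum_boole]
    have : Finset.filter (fun k : ℕ => (k : ℝ) + 1 ≤ y) (Finset.range N)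
        = Finset.range ⌊y⌋₊ := by
      ext k
      have h1 : (k : ℝ) + 1 ≤ y ↔ k + 1 ≤ ⌊y⌋₊ := by
        rw [Nat.le_floor_iff hy]; push_cast; rfl
      have h2 : ⌊y⌋₊ ≤ N := by
        have := Nat.floor_le_floor hN
        simpa using this
      simp only [Finset.mem_filter, Finset.mem_range, h1]
      omega
    rw [this, Finset.card_range]
  rw [h, abs_le]
  have := Nat.floor_le hy
  have := Nat.lt_floor_add_one y
  constructor <;> linarith

lemma count_ge (N : ℕ) (y : ℝ) (hy : 0 < y) (hN : y ≤ N) :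
    |(N - ∑ k : Fin N, if y ≤ ((k : ℕ) : ℝ) + 1 then (1 : ℝ) else 0) - y| ≤ 1 := by
  have h : (N - ∑ k : Fin N, if y ≤ ((k : ℕ) : ℝ) + 1 then (1 : ℝ) else 0)
      = ((⌈y⌉₊ - 1 : ℕ) : ℝ) := by
    have h0 : (N : ℝ) = ∑ k : Fin N, (1 : ℝ) := by simp
    rw [h0, ← Finset.sum_sub_distrib]
    have h3 : ∀ k : Fin N, (1 : ℝ) - (if y ≤ ((k : ℕ) : ℝ) + 1 then (1 : ℝ) else 0)
        = if ((k : ℕ) : ℝ) + 1 < y then (1 : ℝ) else 0 := by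
      intro k
      by_cases hk : y ≤ ((k : ℕ) : ℝ) + 1
      · simp [hk, not_lt.mpr hk]
      · simp [hk, not_le.mp hk]
    rw [Finset.sum_congr rfl (fun k _ => h3 k),
      Fin.sum_univ_eq_sum_range (fun k => if (k : ℝ) + 1 < y then (1 : ℝ) else 0) N,
      Finset.sum_boole]
    have : Finset.filter (fun k : ℕ => (k : ℝ) + 1 < y) (Finset.range N)
        = Finset.range (⌈y⌉₊ - 1) := by
      ext k
      have h1 : (k : ℝ) + 1 < y ↔ k + 1 < ⌈y⌉₊ := by
        rw [Nat.lt_ceil]; push_cast; rfl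
      have h2 : ⌈y⌉₊ ≤ N := Nat.ceil_le.mpr hN
      simp only [Finset.mem_filter, Finset.mem_range, h1]
      omega
    rw [this, Finset.card_range]
  have hp : 1 ≤ ⌈y⌉₊ := Nat.ceil_pos.mpr hy
  rw [h, abs_le, Nat.cast_sub hp]
  have := Nat.le_ceil y
  have := Nat.ceil_lt_add_one hy.le
  push_cast
  constructor <;> linarith

/-- The inversion function `x ↦ 1/x` on `[-C, -δ] ∪ [δ, C]` is uniformly approximable to
accuracy `ε` by a linear combination of `O(log(1/(εδ))/(εδ) + log C)` threshold (step)
functions. -/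
theorem inverse_approx_by_thresholds :
    ∃ K : ℝ, 0 < K ∧
      ∀ ε δ : ℝ, ε ∈ Set.Ioc (0 : ℝ) 1 → δ ∈ Set.Ioc (0 : ℝ) 1 →
        ∀ C : ℝ, 1 ≤ C →
          ∃ m : ℕ, (m : ℝ) ≤ K * (Real.log (1 / (ε * δ)) / (ε * δ) + Real.log C + 1) ∧
            ∃ c t : Fin m → ℝ,
              ∀ x ∈ Set.Icc (-C) (-δ) ∪ Set.Icc δ C,
                |(∑ i, c i * if t i ≤ x then (1 : ℝ) else 0) - 1 / x| ≤ ε := by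
  refine ⟨5, by norm_num, ?_⟩
  rintro ε δ ⟨hε, hε1⟩ ⟨hδ, hδ1⟩ C hC
  have hp : 0 < ε * δ := mul_pos hε hδ
  have hp1 : ε * δ ≤ 1 := mul_le_one₀ hε1 hδ.le hδ1
  obtain ⟨u, hu⟩ : ∃ u, u = 1 / (ε * δ) := ⟨_, rfl⟩
  have hu1 : 1 ≤ u := by rw [hu, le_div_iff₀ hp]; linarith
  obtain ⟨N, hN⟩ : ∃ N, N = ⌈u⌉₊ := ⟨_, rfl⟩
  have huN : u ≤ N := hN ▸ Nat.le_ceil u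
  have hNu : (N : ℝ) < u + 1 := hN ▸ Nat.ceil_lt_add_one (by linarith)
  let e := Fintype.equivFin ((Fin N ⊕ Fin N) ⊕ Unit)
  have hcard : Fintype.card ((Fin N ⊕ Fin N) ⊕ Unit) = N + N + 1 := by simp
  let c : (Fin N ⊕ Fin N) ⊕ Unit → ℝ := Sum.elim (fun _ => -ε) (fun _ => 2 * ε * N)
  let t : (Fin N ⊕ Fin N) ⊕ Unit → ℝ :=
    Sum.elim (Sum.elim (fun k => -(1 / (((k : ℕ) + 1) * ε))) (fun k => 1 / (((k : ℕ) + 1) * ε)))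
      (fun _ => 0)
  refine ⟨Fintype.card ((Fin N ⊕ Fin N) ⊕ Unit), ?_, c ∘ e.symm, t ∘ e.symm, ?_⟩
  · rw [hcard]
    have h1 : Real.log (1 / (ε * δ)) / (ε * δ) = u * Real.log u := by
      rw [← hu, hu]; ring
    have h2 : 1 - u⁻¹ ≤ Real.log u := Real.one_sub_inv_le_log_of_pos (by linarith)
    have h3 : u - 1 ≤ u * Real.log u := by
      have := mul_le_mul_of_nonneg_left h2 (by linarith : 0 ≤ u)
      rwa [mul_sub, mul_inv_cancel₀ (by linarith), mul_one] at this
    have h4 := Real.log_nonneg hC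
    rw [h1]; push_cast; linarith
  · intro x hx
    have hs : (∑ i, (c ∘ e.symm) i * if (t ∘ e.symm) i ≤ x then (1 : ℝ) else 0)
        = ∑ j, c j * if t j ≤ x then (1 : ℝ) else 0 :=
      Equiv.sum_comp e.symm (fun j => c j * if t j ≤ x then (1 : ℝ) else 0)
    rw [hs, Fintype.sum_sum_type, Fintype.sum_sum_type]
    simp only [c, t, Sum.elim_inl, Sum.elim_inr, ← Finset.mul_sum]
    have hk : ∀ k : Fin N, 0 < (((k : ℕ) : ℝ) + 1) * ε := fun k => by positivity
    rcases hx with ⟨_, hx⟩ | ⟨hx, _⟩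
    · have hx0 : 0 < -x := by linarith
      obtain ⟨y, hy⟩ : ∃ y, y = 1 / (-x * ε) := ⟨_, rfl⟩
      have hy0 : 0 < y := by rw [hy]; positivity
      have hyN : y ≤ N := by
        refine le_trans ?_ huN
        rw [hy, hu, mul_comm ε δ]
        gcongr; linarith
      have e1 : ∀ k : Fin N, (-(1 / ((((k : ℕ) : ℝ) + 1) * ε)) ≤ x) ↔ (((k : ℕ) : ℝ) + 1 ≤ y) := by
        intro k
        rw [neg_le, le_div_iff₀ (hk k), hy, le_div_iff₀ (by positivity)]
        constructor <;> intro h <;> linarith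
      have e2 : ∀ k : Fin N, ¬ ((1 / ((((k : ℕ) : ℝ) + 1) * ε)) ≤ x) := by
        intro k
        have := one_div_pos.mpr (hk k)
        linarith
      have e3 : ¬ (0 ≤ x) := by linarith
      have hxy : 1 / x = -(ε * y) := by
        have : x ≠ 0 := by linarith
        rw [hy]; field_simp
      have := count_le N y hy0.le hyN
      simp only [e1, e2, e3, if_false, Finset.sum_const_zero, mul_zero, add_zero, hxy]
      rw [show ∀ S : ℝ, -ε * S - -(ε * y) = -(ε * (S - y)) from fun S => by ring, abs_neg,
        abs_mul, abs_of_pos hε]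
      exact mul_le_of_le_one_right hε.le this
    · have hx0 : 0 < x := by linarith
      obtain ⟨y, hy⟩ : ∃ y, y = 1 / (x * ε) := ⟨_, rfl⟩
      have hy0 : 0 < y := by rw [hy]; positivity
      have hyN : y ≤ N := by
        refine le_trans ?_ huN
        rw [hy, hu, mul_comm ε δ]
        gcongr
      have e1 : ∀ k : Fin N, ((1 / ((((k : ℕ) : ℝ) + 1) * ε)) ≤ x) ↔ (y ≤ ((k : ℕ) : ℝ) + 1) := by
        intro k
        rw [div_le_iff₀ (hk k), hy, div_le_iff₀ (by positivity)]
        constructor <;> intro h <;> linarith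
      have e2 : ∀ k : Fin N, (-(1 / ((((k : ℕ) : ℝ) + 1) * ε)) ≤ x) := by
        intro k
        have := one_div_pos.mpr (hk k)
        linarith
      have hxy : 1 / x = ε * y := by
        rw [hy]; field_simp
      have := count_ge N y hy0 hyN
      simp only [e1, e2, hx0.le, if_true, hxy, Finset.sum_const, Finset.card_univ,
        Fintype.card_fin, nsmul_eq_mul, mul_one, Fintype.card_unit, one_smul, Nat.cast_one, one_mul]
      rw [show ∀ S : ℝ, -ε * N + -ε * S + 2 * ε * N - ε * y = ε * ((N - S) - y) from
        fun S => by ring, abs_mul, abs_of_pos hε]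
      exact mul_le_of_le_one_right hε.le this
end

section
/- There exists a constant K > 0 such that for all ε, δ ∈ (0, 1] and all C ≥ 1, there exist a natural number m with m ≤ K·(log(1/(εδ))/(εδ) + log C + 1) and reals c_i, w_i, b_i for 1 ≤ i ≤ m such that for every x ∈ [δ, C], |Σ_{i=1}^m c_i · σ(w_i x + b_i) − 1/x| ≤ ε. That is, the inversion function x ↦ 1/x on [δ, C] is uniformly approximable by a linear combination of sigmoids whose number of terms is O(log(1/(εδ))/(εδ) + log C). -/
lemma sum_ind (N a : ℕ) : ∑ i : Fin N, (if (i : ℕ) < a then (1 : ℝ) else 0) = ((min N a : ℕ) : ℝ) := by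
  rw [Fin.sum_univ_eq_sum_range (fun i => if i < a then (1 : ℝ) else 0) N]
  induction N with
  | zero => simp
  | succ N ih =>
    rw [Finset.sum_range_succ, ih]
    split_ifs with h
    · rw [min_eq_left h.le, min_eq_left (by omega)]; push_cast; rfl
    · rw [min_eq_right (by omega), min_eq_right (by omega)]; simp

lemma sig_pos (t : ℝ) : 0 ≤ sigmoid t := by unfold sigmoid; positivity

lemma sig_le_one (t : ℝ) : sigmoid t ≤ 1 := by
  unfold sigmoid
  rw [div_le_one (by positivity)]
  linarith [Real.exp_pos (-t)]

lemma exp_small (N : ℕ) (hN : 0 < N) : Real.exp (-(N : ℝ)) ≤ 1 / N := by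
  have h0 : (0 : ℝ) < N := by exact_mod_cast hN
  rw [Real.exp_neg, ← one_div]
  apply one_div_le_one_div_of_le h0
  linarith [Real.add_one_le_exp (N : ℝ)]

lemma sig_hi (N : ℕ) (hN : 0 < N) (t : ℝ) (h : (N : ℝ) ≤ t) : 1 - 1 / N ≤ sigmoid t := by
  have h1 := exp_small N hN
  have h2 : Real.exp (-t) ≤ Real.exp (-(N : ℝ)) := Real.exp_le_exp.2 (by linarith)
  have h3 : 1 - Real.exp (-t) ≤ sigmoid t := by
    unfold sigmoid
    rw [le_div_iff₀ (by positivity)]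
    nlinarith [Real.exp_pos (-t)]
  linarith

lemma sig_lo (N : ℕ) (hN : 0 < N) (t : ℝ) (h : t ≤ -(N : ℝ)) : sigmoid t ≤ 1 / N := by
  have h1 := exp_small N hN
  have h2 : Real.exp t ≤ Real.exp (-(N : ℝ)) := Real.exp_le_exp.2 h
  have h3 : sigmoid t ≤ Real.exp t := by
    unfold sigmoid
    rw [div_le_iff₀ (by positivity), mul_add, ← Real.exp_add]
    simp [Real.exp_nonneg]
  linarith

/-- The inversion function `x ↦ 1/x` on `[δ, C]` is uniformly approximable to accuracy
`ε` by a linear combination of `O(log(1/(εδ))/(εδ) + log C)` sigmoids. -/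
theorem inverse_approx_by_sigmoids :
    ∃ K : ℝ, 0 < K ∧
      ∀ ε δ : ℝ, ε ∈ Set.Ioc (0 : ℝ) 1 → δ ∈ Set.Ioc (0 : ℝ) 1 →
        ∀ C : ℝ, 1 ≤ C →
          ∃ m : ℕ, (m : ℝ) ≤ K * (Real.log (1 / (ε * δ)) / (ε * δ) + Real.log C + 1) ∧
            ∃ c w b : Fin m → ℝ,
              ∀ x ∈ Set.Icc δ C,
                |(∑ i, c i * sigmoid (w i * x + b i)) - 1 / x| ≤ ε := by
  refine ⟨4, by norm_num, ?_⟩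
  rintro ε δ ⟨hε, hε1⟩ ⟨hδ, hδ1⟩ C hC
  have hp : 0 < ε * δ := by positivity
  have hp1 : ε * δ ≤ 1 := by nlinarith
  obtain ⟨N, hNdef⟩ : ∃ N : ℕ, N = ⌈3 / (ε * δ)⌉₊ := ⟨_, rfl⟩
  have hN1 : 3 / (ε * δ) ≤ N := by rw [hNdef]; exact Nat.le_ceil _
  have hN2 : (N : ℝ) < 3 / (ε * δ) + 1 := by rw [hNdef]; exact Nat.ceil_lt_add_one (by positivity)
  have hN0 : (0 : ℝ) < N := lt_of_lt_of_le (by positivity) hN1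
  have hN : 0 < N := by exact_mod_cast hN0
  refine ⟨N, ?_, fun _ => ε / 3, fun _ => -((N : ℝ) ^ 3 * (ε / 3)),
    fun i => (N : ℝ) ^ 3 / ((i : ℕ) + 1 : ℝ), ?_⟩
  · have hlog : 1 - ε * δ ≤ Real.log (1 / (ε * δ)) := by
      rw [one_div, Real.log_inv]
      linarith [Real.log_le_sub_one_of_pos hp]
    have h1 : (1 - ε * δ) / (ε * δ) ≤ Real.log (1 / (ε * δ)) / (ε * δ) := by gcongr
    have h2 : (1 - ε * δ) / (ε * δ) = 1 / (ε * δ) - 1 := by field_simp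
    have h3 : 1 ≤ 1 / (ε * δ) := by rw [le_div_iff₀ hp]; linarith
    have h4 : 3 / (ε * δ) = 3 * (1 / (ε * δ)) := by ring
    have h5 := Real.log_nonneg hC
    linarith
  · rintro x ⟨hx, -⟩
    have hx0 : 0 < x := lt_of_lt_of_le hδ hx
    obtain ⟨k, hk⟩ : ∃ k : ℝ, k = 3 / (ε * x) := ⟨_, rfl⟩
    have hk0 : 0 < k := by rw [hk]; positivity
    have hkN : k ≤ N := by
      refine le_trans ?_ hN1
      rw [hk]; gcongr
    have hxk : x = 3 / (ε * k) := by rw [hk]; field_simp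
    have hinv : 1 / x = ε / 3 * k := by rw [hk]; field_simp
    obtain ⟨n, hn⟩ : ∃ n : ℕ, n = ⌊k⌋₊ := ⟨_, rfl⟩
    have hn1 : (n : ℝ) ≤ k := by rw [hn]; exact Nat.floor_le hk0.le
    have hn2 : k < n + 1 := by rw [hn]; exact Nat.lt_floor_add_one k
    have hnN : n ≤ N := by exact_mod_cast hn1.trans hkN
    have harg : ∀ i : Fin N, -((N : ℝ) ^ 3 * (ε / 3)) * x + (N : ℝ) ^ 3 / ((i : ℕ) + 1 : ℝ)
        = N ^ 3 * (k - ((i : ℕ) + 1)) / (((i : ℕ) + 1) * k) := by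
      intro i
      have : ((i : ℕ) + 1 : ℝ) ≠ 0 := by positivity
      rw [hxk]; field_simp; ring
    have hjN : ∀ i : Fin N, ((i : ℕ) + 1 : ℝ) ≤ N := fun i => by exact_mod_cast i.2
    have hjk : ∀ i : Fin N, ((i : ℕ) + 1 : ℝ) * k ≤ N * N := fun i =>
      mul_le_mul (hjN i) hkN hk0.le hN0.le
    have lo : ∀ i : Fin N, (if (i : ℕ) < n - 1 then (1 : ℝ) else 0) - 1 / N ≤
        sigmoid (-((N : ℝ) ^ 3 * (ε / 3)) * x + (N : ℝ) ^ 3 / ((i : ℕ) + 1 : ℝ)) := by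
      intro i
      split_ifs with h
      · apply sig_hi N hN
        have h' : ((i : ℕ) + 2 : ℝ) ≤ n := by exact_mod_cast (by omega : (i : ℕ) + 2 ≤ n)
        rw [harg, le_div_iff₀ (by positivity)]
        calc (N : ℝ) * (((i : ℕ) + 1) * k) ≤ N * (N * N) := by gcongr; exact hjN i
          _ = N ^ 3 * 1 := by ring
          _ ≤ _ := by gcongr; linarith
      · have : 0 < 1 / (N : ℝ) := by positivity
        linarith [sig_pos (-((N : ℝ) ^ 3 * (ε / 3)) * x + (N : ℝ) ^ 3 / ((i : ℕ) + 1 : ℝ))]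
    have hi : ∀ i : Fin N,
        sigmoid (-((N : ℝ) ^ 3 * (ε / 3)) * x + (N : ℝ) ^ 3 / ((i : ℕ) + 1 : ℝ)) ≤
        (if (i : ℕ) < n + 1 then (1 : ℝ) else 0) + 1 / N := by
      intro i
      split_ifs with h
      · have : 0 < 1 / (N : ℝ) := by positivity
        linarith [sig_le_one (-((N : ℝ) ^ 3 * (ε / 3)) * x + (N : ℝ) ^ 3 / ((i : ℕ) + 1 : ℝ))]
      · rw [zero_add]
        apply sig_lo N hN
        have h' : (n + 1 : ℝ) ≤ (i : ℕ) := by exact_mod_cast (by omega : n + 1 ≤ (i : ℕ))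
        rw [harg, div_le_iff₀ (by positivity)]
        have e1 : (N : ℝ) * (((i : ℕ) + 1) * k) ≤ N ^ 3 * (((i : ℕ) + 1) - k) := by
          calc (N : ℝ) * (((i : ℕ) + 1) * k) ≤ N * (N * N) := by gcongr; exact hjN i
            _ = N ^ 3 * 1 := by ring
            _ ≤ _ := by gcongr; linarith
        linarith
    have Slo := Finset.sum_le_sum (fun i (_ : i ∈ Finset.univ) => lo i)
    have Shi := Finset.sum_le_sum (fun i (_ : i ∈ Finset.univ) => hi i)
    rw [Finset.sum_sub_distrib, sum_ind, min_eq_right (by omega)] at Slo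
    rw [Finset.sum_add_distrib, sum_ind] at Shi
    have hc : ∑ i : Fin N, 1 / (N : ℝ) = 1 := by simp; field_simp
    rw [hc] at Slo Shi
    have m1 : ((min N (n + 1) : ℕ) : ℝ) ≤ n + 1 := by exact_mod_cast min_le_right _ _
    have m2 : (n : ℝ) - 1 ≤ ((n - 1 : ℕ) : ℝ) := by
      have : (n : ℝ) ≤ ((n - 1 : ℕ) : ℝ) + 1 := by exact_mod_cast (by omega : n ≤ n - 1 + 1)
      linarith
    rw [← Finset.mul_sum, hinv, ← mul_sub, abs_mul, abs_of_pos (by positivity : 0 < ε / 3)]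
    have : |∑ i : Fin N, sigmoid (-((N : ℝ) ^ 3 * (ε / 3)) * x + (N : ℝ) ^ 3 / ((i : ℕ) + 1 : ℝ)) - k| ≤ 3 := by
      rw [abs_le]; constructor <;> linarith
    calc _ ≤ ε / 3 * 3 := by gcongr
      _ = ε := by ring
end

section
/- There exists a constant K > 0 such that for all ε ∈ (0, 1] and all C ≥ 1, there exist a natural number m with m ≤ K·(√C/ε + 1) and reals c_i, w_i, b_i for 1 ≤ i ≤ m such that for every x ∈ [0, C], |Σ_{i=1}^m c_i · σ(w_i x + b_i) − √x| ≤ ε. That is, the square root function on [0, C] is uniformly approximable by a linear combination of sigmoids whose number of terms is O(√C/ε). -/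
lemma clamp_sum (u : ℝ) (n : ℕ) :
    ∑ k ∈ Finset.range n, max 0 (min 1 (u - k)) = max 0 (min (n : ℝ) u) := by
  induction n with
  | zero =>
    simp
  | succ n ih =>
    have hn : (0 : ℝ) ≤ n := Nat.cast_nonneg n
    rw [Finset.sum_range_succ, ih]
    push_cast
    simp only [max_def, min_def]
    split_ifs <;> linarith

lemma sigmoid_pos' (z : ℝ) : 0 < sigmoid z := by
  unfold sigmoid
  positivity

lemma sigmoid_le_one' (z : ℝ) : sigmoid z ≤ 1 := by
  unfold sigmoid
  rw [div_le_one (by positivity)]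
  linarith [Real.exp_pos (-z)]

lemma sigmoid_small (a z : ℝ) (ha : 0 < a) (hz : z ≤ -a) : sigmoid z ≤ 1 / a := by
  unfold sigmoid
  have := Real.add_one_le_exp (-z)
  exact one_div_le_one_div_of_le ha (by linarith)

lemma sigmoid_neg' (z : ℝ) : sigmoid (-z) = 1 - sigmoid z := by
  unfold sigmoid
  rw [neg_neg, Real.exp_neg]
  have := Real.exp_pos z
  field_simp
  ring

lemma sigmoid_large (a z : ℝ) (ha : 0 < a) (hz : a ≤ z) : 1 - 1 / a ≤ sigmoid z := by
  have := sigmoid_small a (-z) ha (by linarith)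
  rw [sigmoid_neg'] at this
  linarith

lemma stair (n : ℕ) (hn : 0 < n) (t : ℝ) (ht : 0 ≤ t) (htn : t ≤ n) :
    |∑ k ∈ Finset.range n, sigmoid (n * (t ^ 2 - ((k : ℝ) + 1) ^ 2)) - t| ≤ 3 := by
  have hn' : (0 : ℝ) < n := by exact_mod_cast hn
  have hsum : ∑ k ∈ Finset.range n, (1 / (n : ℝ)) = 1 := by
    simp
    field_simp
  have hup : ∑ k ∈ Finset.range n, sigmoid (n * (t ^ 2 - ((k : ℝ) + 1) ^ 2)) ≤
      ∑ k ∈ Finset.range n, (1 / (n : ℝ) + max 0 (min 1 ((t + 1) - k))) := by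
    apply Finset.sum_le_sum
    intro k _
    have hk : (0 : ℝ) ≤ k := Nat.cast_nonneg k
    have h1 : 0 < 1 / (n : ℝ) := by positivity
    rcases le_total t k with h | h
    · have := sigmoid_small n (n * (t ^ 2 - ((k : ℝ) + 1) ^ 2)) hn' (by
        have : t ^ 2 - ((k : ℝ) + 1) ^ 2 ≤ -1 := by nlinarith
        nlinarith)
      linarith [le_max_left 0 (min 1 ((t + 1) - (k : ℝ)))]
    · rw [min_eq_left (by linarith), max_eq_right (by norm_num)]
      linarith [sigmoid_le_one' (n * (t ^ 2 - ((k : ℝ) + 1) ^ 2))]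
  have hlo : ∑ k ∈ Finset.range n, (max 0 (min 1 ((t - 2) - k)) - 1 / (n : ℝ)) ≤
      ∑ k ∈ Finset.range n, sigmoid (n * (t ^ 2 - ((k : ℝ) + 1) ^ 2)) := by
    apply Finset.sum_le_sum
    intro k _
    have hk : (0 : ℝ) ≤ k := Nat.cast_nonneg k
    have h1 : 0 < 1 / (n : ℝ) := by positivity
    rcases le_total (k + 2 : ℝ) t with h | h
    · have := sigmoid_large n (n * (t ^ 2 - ((k : ℝ) + 1) ^ 2)) hn' (by
        have : 1 ≤ t ^ 2 - ((k : ℝ) + 1) ^ 2 := by nlinarith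
        nlinarith)
      have h2 : max 0 (min 1 ((t - 2) - (k : ℝ))) ≤ 1 :=
        max_le (by norm_num) (min_le_left _ _)
      linarith
    · rw [max_eq_left ((min_le_right _ _).trans (by linarith))]
      linarith [sigmoid_pos' (n * (t ^ 2 - ((k : ℝ) + 1) ^ 2))]
  rw [Finset.sum_add_distrib, hsum, clamp_sum] at hup
  rw [Finset.sum_sub_distrib, hsum, clamp_sum, min_eq_right (by linarith)] at hlo
  have h3 : max 0 (min (n : ℝ) (t + 1)) ≤ t + 1 := max_le (by linarith) (min_le_right _ _)
  have h4 := le_max_right 0 (t - 2)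
  rw [abs_le]
  constructor <;> linarith

/-- The square root function on `[0, C]` is uniformly approximable to accuracy `ε` by a
linear combination of `O(√C/ε)` sigmoids. -/
theorem sqrt_approx_by_sigmoids :
    ∃ K : ℝ, 0 < K ∧
      ∀ ε : ℝ, ε ∈ Set.Ioc (0 : ℝ) 1 →
        ∀ C : ℝ, 1 ≤ C →
          ∃ m : ℕ, (m : ℝ) ≤ K * (Real.sqrt C / ε + 1) ∧
            ∃ c w b : Fin m → ℝ,
              ∀ x ∈ Set.Icc (0 : ℝ) C,
                |(∑ i, c i * sigmoid (w i * x + b i)) - Real.sqrt x| ≤ ε := by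
  refine ⟨3, by norm_num, ?_⟩
  rintro ε ⟨hε, -⟩ C hC
  have hsC : 0 < Real.sqrt C := Real.sqrt_pos.2 (by linarith)
  have hpos : 0 < 3 * (Real.sqrt C / ε) := by positivity
  set n := ⌈3 * (Real.sqrt C / ε)⌉₊ with hn
  have hn0 : 0 < n := Nat.ceil_pos.2 hpos
  refine ⟨n, ?_, fun _ => ε / 3, fun _ => n / (ε / 3) ^ 2,
    fun i => -(n * (((i : ℕ) : ℝ) + 1) ^ 2), ?_⟩
  · have := Nat.ceil_lt_add_one hpos.le
    linarith
  · rintro x ⟨hx0, hxC⟩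
    have hs := Real.sq_sqrt hx0
    have hle := Real.sqrt_le_sqrt hxC
    have hkey := stair n hn0 (Real.sqrt x / (ε / 3)) (by positivity) (by
      refine le_trans ?_ (Nat.le_ceil _)
      have : Real.sqrt x / (ε / 3) = 3 * (Real.sqrt x / ε) := by field_simp
      rw [this]
      gcongr)
    rw [← Finset.mul_sum, Fin.sum_univ_eq_sum_range
      (fun k : ℕ => sigmoid (n / (ε / 3) ^ 2 * x + -(n * ((k : ℝ) + 1) ^ 2)))]
    have he : ∀ k : ℕ, n / (ε / 3) ^ 2 * x + -(n * ((k : ℝ) + 1) ^ 2) =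
        n * ((Real.sqrt x / (ε / 3)) ^ 2 - ((k : ℝ) + 1) ^ 2) := by
      intro k
      rw [div_pow (Real.sqrt x), hs]
      ring
    simp only [he]
    set S := ∑ k ∈ Finset.range n, sigmoid (n * ((Real.sqrt x / (ε / 3)) ^ 2 - ((k : ℝ) + 1) ^ 2))
    have : ε / 3 * S - Real.sqrt x = ε / 3 * (S - Real.sqrt x / (ε / 3)) := by
      field_simp
    rw [this, abs_mul, abs_of_pos (by positivity : 0 < ε / 3)]
    nlinarith
end
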